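/- arXiv:1207.2824 — 2 statements merged into one kernel-verified Lean document; each statement's English description precedes it below -/
import Mathlib

section
/- For all 0 ≤ i ≤ n−2, all m, m' ∈ ℤ, and both choices of sign ±, the operators on the Fock module V satisfy [x_i^±(m), x_n^±(m')] = 0, where [·,·] is the commutator of operators. -/
noncomputable section

open scoped BigOperators

/-- Bosonic labels: `none` is β, `some i` is ε_{i+1} (so ε_1, …, ε_n). -/
abbrev BL (n : ℕ) := Option (Fin n)

/-- The symmetric pairing on bosonic labels: (β|β)=1, (β|ε_i)=δ_{i1}, (ε_i|ε_j)=δ_{ij}. -/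
def pairB (n : ℕ) : BL n → BL n → ℂ
  | none, none => 1
  | none, some i => if (i : ℕ) = 0 then 1 else 0
  | some i, none => if (i : ℕ) = 0 then 1 else 0
  | some i, some j => if i = j then 1 else 0

/-- Generators of Λ: unstarred bosons u(k), starred bosons u*(k), and the ghost e(k). -/
inductive TGen (n : ℕ) : Type
  | un : BL n → ℤ → TGen n
  | st : BL n → ℤ → TGen n
  | e : ℤ → TGen n

open FreeAlgebra in
/-- Defining relations of Λ. -/
inductive TRel (n : ℕ) : FreeAlgebra ℂ (TGen n) → FreeAlgebra ℂ (TGen n) → Prop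
  | unun (u v : BL n) (k l : ℤ) :
      TRel n (ι ℂ (TGen.un u k) * ι ℂ (TGen.un v l)) (ι ℂ (TGen.un v l) * ι ℂ (TGen.un u k))
  | stst (u v : BL n) (k l : ℤ) :
      TRel n (ι ℂ (TGen.st u k) * ι ℂ (TGen.st v l)) (ι ℂ (TGen.st v l) * ι ℂ (TGen.st u k))
  | unst (u v : BL n) (k l : ℤ) :
      TRel n (ι ℂ (TGen.un u k) * ι ℂ (TGen.st v l))
        (ι ℂ (TGen.st v l) * ι ℂ (TGen.un u k) +
          algebraMap ℂ _ (if k + l = 0 then pairB n u v else 0))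
  | une (u : BL n) (k l : ℤ) :
      TRel n (ι ℂ (TGen.un u k) * ι ℂ (TGen.e l)) (ι ℂ (TGen.e l) * ι ℂ (TGen.un u k))
  | ste (u : BL n) (k l : ℤ) :
      TRel n (ι ℂ (TGen.st u k) * ι ℂ (TGen.e l)) (ι ℂ (TGen.e l) * ι ℂ (TGen.st u k))
  | ee (k l : ℤ) :
      TRel n (ι ℂ (TGen.e k) * ι ℂ (TGen.e l) + ι ℂ (TGen.e l) * ι ℂ (TGen.e k))
        (algebraMap ℂ _ (if k + l = 0 then (1 : ℂ) else 0))

/-- The algebra Λ. -/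
abbrev Lam (n : ℕ) := RingQuot (TRel n)

/-- Image of a generator in Λ. -/
def gen (n : ℕ) (x : TGen n) : Lam n :=
  RingQuot.mkAlgHom ℂ (TRel n) (FreeAlgebra.ι ℂ x)

/-- The mode index of a generator. -/
def TGen.idx {n : ℕ} : TGen n → ℤ
  | .un _ k => k
  | .st _ k => k
  | .e k => k

/-- The left ideal generated by all generators of index ≥ 1. -/
def fockIdeal (n : ℕ) : Submodule (Lam n) (Lam n) :=
  Submodule.span (Lam n) {a | ∃ x : TGen n, 1 ≤ x.idx ∧ a = gen n x}

/-- The Fock module V = Λ/I. -/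
abbrev Fock (n : ℕ) := Lam n ⧸ fockIdeal n

/-- Series of unstarred bosonic generators. -/
def unS (n : ℕ) (u : BL n) : ℤ → Lam n := fun k => gen n (.un u k)
/-- Series of starred bosonic generators. -/
def stS (n : ℕ) (u : BL n) : ℤ → Lam n := fun k => gen n (.st u k)
/-- Series of ghost generators. -/
def eS (n : ℕ) : ℤ → Lam n := fun k => gen n (.e k)

/-- ε_i(·) for 1 ≤ i ≤ n (1-based index; junk value 0 outside the range). -/
def epU (n : ℕ) (i : ℕ) : ℤ → Lam n :=
  if h : 1 ≤ i ∧ i ≤ n then unS n (some ⟨i - 1, by omega⟩) else 0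
/-- ε_i*(·) for 1 ≤ i ≤ n. -/
def epSt (n : ℕ) (i : ℕ) : ℤ → Lam n :=
  if h : 1 ≤ i ∧ i ≤ n then stS n (some ⟨i - 1, by omega⟩) else 0

/-- Normal ordering of a bosonic pair :x(k)y(l): as an element of Λ. -/
def nob (n : ℕ) (x y : ℤ → Lam n) (k l : ℤ) : Lam n :=
  if k < 0 then x k * y l
  else if 0 < k then y l * x k
  else (2⁻¹ : ℂ) • (x 0 * y l + y l * x 0)

/-- The operator on V given by the locally finite sum Σ_{k∈ℤ} f(k)·(·). -/
def sumOp (n : ℕ) (f : ℤ → Lam n) : Fock n → Fock n := fun v => ∑ᶠ k : ℤ, f k • v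

/-- α_i(m), 0 ≤ i ≤ n. -/
def αop (n : ℕ) (i : ℕ) (m : ℤ) : Fock n → Fock n :=
  if i = 0 then sumOp n (fun k => (-2 : ℂ) • nob n (stS n none) (unS n none) k (m - k))
  else if i = n then sumOp n (fun k => nob n (epU n n) (epSt n n) k (m - k))
  else sumOp n (fun k =>
    nob n (epU n i) (epSt n i) k (m - k) - nob n (epU n (i + 1)) (epSt n (i + 1)) k (m - k))

/-- x_i^+(m), 0 ≤ i ≤ n. -/
def xp (n : ℕ) (i : ℕ) (m : ℤ) : Fock n → Fock n :=
  if i = 0 then sumOp n (fun k => (2⁻¹ : ℂ) • nob n (stS n none) (stS n none) k (m - k))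
  else if i = n then sumOp n (fun k => ((Real.sqrt 2 : ℝ) : ℂ) • (epU n n k * eS n (m - k)))
  else sumOp n (fun k => nob n (epU n i) (epSt n (i + 1)) k (m - k))

/-- x_i^−(m), 0 ≤ i ≤ n. -/
def xm (n : ℕ) (i : ℕ) (m : ℤ) : Fock n → Fock n :=
  if i = 0 then sumOp n (fun k => (2⁻¹ : ℂ) • nob n (unS n none) (unS n none) k (m - k))
  else if i = n then sumOp n (fun k => (-((Real.sqrt 2 : ℝ) : ℂ)) • (epSt n n k * eS n (m - k)))
  else sumOp n (fun k => -(nob n (epU n (i + 1)) (epSt n i) k (m - k)))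

/-- The vector ε_i (1 ≤ i ≤ n) as a coefficient function on bosonic labels. -/
def epsVec (n : ℕ) (i : ℕ) : BL n → ℂ
  | none => 0
  | some j => if (j : ℕ) + 1 = i then 1 else 0

/-- The vector β as a coefficient function. -/
def betaVec (n : ℕ) : BL n → ℂ
  | none => 1
  | some _ => 0

/-- Bilinear extension of the pairing to ℂ-linear combinations of β, ε_1, …, ε_n. -/
def formC (n : ℕ) (f g : BL n → ℂ) : ℂ := ∑ u : BL n, ∑ v : BL n, f u * g v * pairB n u v

/-- The root vectors: α_0 = −2β, α_i = ε_i − ε_{i+1} (1 ≤ i ≤ n−1), α_n = ε_n. -/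
def αvec (n : ℕ) (i : ℕ) : BL n → ℂ :=
  if i = 0 then fun u => -2 * betaVec n u
  else if i = n then epsVec n n
  else fun u => epsVec n i u - epsVec n (i + 1) u

/-- Generators commute in Λ when this is one of the defining relations. -/
theorem gen_commute_of_rel {n : ℕ} {x y : TGen n}
    (h : TRel n (FreeAlgebra.ι ℂ x * FreeAlgebra.ι ℂ y) (FreeAlgebra.ι ℂ y * FreeAlgebra.ι ℂ x)) :
    Commute (gen n x) (gen n y) := by
  have := RingQuot.mkAlgHom_rel ℂ h
  rw [map_mul, map_mul] at this
  exact this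

theorem unS_commute_unS (n : ℕ) (u v : BL n) (k l : ℤ) : Commute (unS n u k) (unS n v l) :=
  gen_commute_of_rel (.unun u v k l)

theorem stS_commute_stS (n : ℕ) (u v : BL n) (k l : ℤ) : Commute (stS n u k) (stS n v l) :=
  gen_commute_of_rel (.stst u v k l)

theorem unS_commute_eS (n : ℕ) (u : BL n) (k l : ℤ) : Commute (unS n u k) (eS n l) :=
  gen_commute_of_rel (.une u k l)

theorem stS_commute_eS (n : ℕ) (u : BL n) (k l : ℤ) : Commute (stS n u k) (eS n l) :=
  gen_commute_of_rel (.ste u k l)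

theorem unS_mul_stS (n : ℕ) (u v : BL n) (k l : ℤ) :
    unS n u k * stS n v l = stS n v l * unS n u k +
      algebraMap ℂ (Lam n) (if k + l = 0 then pairB n u v else 0) := by
  have := RingQuot.mkAlgHom_rel ℂ (TRel.unst u v k l)
  rw [map_add, map_mul, map_mul, AlgHom.commutes] at this
  exact this

theorem eS_mul_eS (n : ℕ) (k l : ℤ) :
    eS n k * eS n l + eS n l * eS n k =
      algebraMap ℂ (Lam n) (if k + l = 0 then (1 : ℂ) else 0) := by
  have := RingQuot.mkAlgHom_rel ℂ (TRel.ee (n := n) k l)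
  rw [map_add, map_mul, map_mul, AlgHom.commutes] at this
  exact this

theorem pairB_none_some {n : ℕ} {i : Fin n} (h : (i : ℕ) ≠ 0) : pairB n none (some i) = 0 :=
  if_neg h

theorem pairB_some_none {n : ℕ} {i : Fin n} (h : (i : ℕ) ≠ 0) : pairB n (some i) none = 0 :=
  if_neg h

theorem pairB_some_some {n : ℕ} {i j : Fin n} (h : i ≠ j) : pairB n (some i) (some j) = 0 :=
  if_neg h

theorem neg_one_smul_lam {n : ℕ} (a : Lam n) : (-1 : ℂ) • a = -a := by
  rw [Algebra.smul_def, map_neg, map_one]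
  exact neg_one_mul a

theorem unS_commute_stS {n : ℕ} {u v : BL n} (h : pairB n u v = 0) (k l : ℤ) :
    Commute (unS n u k) (stS n v l) := by
  have := unS_mul_stS n u v k l
  simp only [h, ite_self, map_zero, add_zero] at this
  exact this

theorem unS_commute_stS_of_add_ne_zero {n : ℕ} (u v : BL n) {k l : ℤ} (h : k + l ≠ 0) :
    Commute (unS n u k) (stS n v l) := by
  have := unS_mul_stS n u v k l
  simp only [h, if_false, map_zero, add_zero] at this
  exact this

/-- Generators whose indices do not sum to zero commute or anticommute. -/
theorem gen_mul_gen_of_add_ne_zero {n : ℕ} (x y : TGen n) (h : x.idx + y.idx ≠ 0) :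
    gen n x * gen n y = gen n y * gen n x ∨ gen n x * gen n y = -(gen n y * gen n x) := by
  rcases x with ⟨u, k⟩ | ⟨u, k⟩ | k <;> rcases y with ⟨v, l⟩ | ⟨v, l⟩ | l
  · exact .inl (unS_commute_unS n u v k l)
  · exact .inl (unS_commute_stS_of_add_ne_zero u v h)
  · exact .inl (unS_commute_eS n u k l)
  · exact .inl (unS_commute_stS_of_add_ne_zero v u (k := l) (l := k) (add_comm k l ▸ h)).symm
  · exact .inl (stS_commute_stS n u v k l)
  · exact .inl (stS_commute_eS n u k l)
  · exact .inl (unS_commute_eS n v l k).symm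
  · exact .inl (stS_commute_eS n v l k).symm
  · refine .inr (eq_neg_of_add_eq_zero_left ?_)
    have := eS_mul_eS n k l
    have h' : k + l ≠ 0 := h
    rw [if_neg h', map_zero] at this
    exact this

/-- Every element of Λ is reached from 1 by linear combinations and left multiplication by
generators. -/
theorem Lam.induction_left {n : ℕ} {P : Lam n → Prop} (one : P 1)
    (add : ∀ a b, P a → P b → P (a + b)) (smul : ∀ (c : ℂ) a, P a → P (c • a))
    (mul : ∀ x a, P a → P (gen n x * a)) (a : Lam n) : P a := by
  suffices h : ∀ f : FreeAlgebra ℂ (TGen n), ∀ b, P b →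
      P (RingQuot.mkAlgHom ℂ (TRel n) f * b) by
    obtain ⟨f, rfl⟩ := RingQuot.mkAlgHom_surjective ℂ (TRel n) a
    simpa using h f 1 one
  intro f
  induction f using FreeAlgebra.induction with
  | grade0 c =>
    intro b hb
    rw [AlgHom.commutes, ← Algebra.smul_def]
    exact smul c b hb
  | grade1 x => exact fun b hb => mul x b hb
  | mul f g hf hg =>
    intro b hb
    rw [map_mul, mul_assoc]
    exact hf _ (hg b hb)
  | add f g hf hg =>
    intro b hb
    rw [map_add, add_mul]
    exact add _ _ (hf b hb) (hg b hb)

/-- Each vector of the Fock module is annihilated by all generators of large index. -/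
theorem exists_gen_smul_eq_zero {n : ℕ} (v : Fock n) :
    ∃ N : ℤ, ∀ x : TGen n, N ≤ x.idx → gen n x • v = 0 := by
  obtain ⟨a, rfl⟩ := Submodule.Quotient.mk_surjective _ v
  induction a using Lam.induction_left with
  | one =>
    refine ⟨1, fun x hx => ?_⟩
    rw [← Submodule.Quotient.mk_smul, Submodule.Quotient.mk_eq_zero, smul_eq_mul, mul_one]
    exact Submodule.subset_span ⟨x, hx, rfl⟩
  | add a b ha hb =>
    obtain ⟨N, hN⟩ := ha
    obtain ⟨M, hM⟩ := hb
    refine ⟨max N M, fun x hx => ?_⟩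
    rw [Submodule.Quotient.mk_add, smul_add, hN x (le_trans (le_max_left _ _) hx),
      hM x (le_trans (le_max_right _ _) hx), add_zero]
  | smul c a ha =>
    obtain ⟨N, hN⟩ := ha
    refine ⟨N, fun x hx => ?_⟩
    rw [Algebra.smul_def, ← smul_eq_mul, Submodule.Quotient.mk_smul, smul_smul,
      ← Algebra.commutes, mul_smul, hN x hx, smul_zero]
  | mul y a ha =>
    obtain ⟨N, hN⟩ := ha
    refine ⟨max N (1 - y.idx), fun x hx => ?_⟩
    have hx₁ := hN x (le_trans (le_max_left _ _) hx)
    have hx₂ := le_trans (le_max_right _ _) hx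
    rw [← smul_eq_mul, Submodule.Quotient.mk_smul, smul_smul]
    rcases gen_mul_gen_of_add_ne_zero x y (by omega) with h | h
    · rw [h, mul_smul, hx₁, smul_zero]
    · rw [h, neg_smul, mul_smul, hx₁, smul_zero, neg_zero]

/-- A series whose modes of large index annihilate any given vector of the Fock module. -/
def IsFieldSeries (n : ℕ) (a : ℤ → Lam n) : Prop :=
  ∀ v : Fock n, ∃ N : ℤ, ∀ k, N ≤ k → a k • v = 0

theorem isFieldSeries_unS (n : ℕ) (u : BL n) : IsFieldSeries n (unS n u) := fun v =>
  (exists_gen_smul_eq_zero v).imp fun _ h k hk => h (.un u k) hk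

theorem isFieldSeries_stS (n : ℕ) (u : BL n) : IsFieldSeries n (stS n u) := fun v =>
  (exists_gen_smul_eq_zero v).imp fun _ h k hk => h (.st u k) hk

theorem isFieldSeries_eS (n : ℕ) : IsFieldSeries n (eS n) := fun v =>
  (exists_gen_smul_eq_zero v).imp fun _ h k hk => h (.e k) hk

/-- A series of operators all but finitely many of which annihilate any given vector. -/
def IsLocallyFinite (n : ℕ) (f : ℤ → Lam n) : Prop :=
  ∀ v : Fock n, (Function.support fun k => f k • v).Finite

theorem IsLocallyFinite.smul {n : ℕ} {f : ℤ → Lam n} (hf : IsLocallyFinite n f) (c : ℂ) :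
    IsLocallyFinite n fun k => c • f k := by
  refine fun v => (hf v).subset fun k hk h => hk ?_
  change (c • f k) • v = 0
  rw [Algebra.smul_def, mul_smul, show f k • v = 0 from h, smul_zero]

theorem IsFieldSeries.isLocallyFinite_nob {n : ℕ} {a b : ℤ → Lam n} (ha : IsFieldSeries n a)
    (hb : IsFieldSeries n b) (m : ℤ) : IsLocallyFinite n fun k => nob n a b k (m - k) := by
  intro v
  obtain ⟨N, hN⟩ := ha v
  obtain ⟨M, hM⟩ := hb v
  refine (Set.finite_Icc (min (m - M) 0) (max N 0)).subset fun k hk => ?_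
  by_contra hk'
  refine hk ?_
  change nob n a b k (m - k) • v = 0
  rw [Set.mem_Icc, not_and_or] at hk'
  rcases hk' with h | h
  · rw [nob, if_pos (by omega), mul_smul, hM _ (by omega), smul_zero]
  · rw [nob, if_neg (by omega), if_pos (by omega), mul_smul, hN _ (by omega), smul_zero]

theorem IsFieldSeries.isLocallyFinite_mul {n : ℕ} {a b : ℤ → Lam n} (ha : IsFieldSeries n a)
    (hb : IsFieldSeries n b) (hab : ∀ k l, Commute (a k) (b l)) (m : ℤ) :
    IsLocallyFinite n fun k => a k * b (m - k) := by
  intro v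
  obtain ⟨N, hN⟩ := ha v
  obtain ⟨M, hM⟩ := hb v
  refine (Set.finite_Icc (m - M) N).subset fun k hk => ?_
  by_contra hk'
  refine hk ?_
  change (a k * b (m - k)) • v = 0
  rw [Set.mem_Icc, not_and_or] at hk'
  rcases hk' with h | h
  · rw [mul_smul, hM _ (by omega), smul_zero]
  · rw [(hab _ _).eq, mul_smul, hN _ (by omega), smul_zero]

theorem Commute.nob_left {n : ℕ} {a b : ℤ → Lam n} {z : Lam n} (ha : ∀ k, Commute (a k) z)
    (hb : ∀ k, Commute (b k) z) (k l : ℤ) : Commute (nob n a b k l) z := by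
  unfold nob
  split_ifs
  · exact (ha k).mul_left (hb l)
  · exact (hb l).mul_left (ha k)
  · exact (((ha 0).mul_left (hb l)).add_left ((hb l).mul_left (ha 0))).smul_left _

/-- Locally finite sums of pairwise commuting operators commute. -/
theorem sumOp_comm {n : ℕ} {f g : ℤ → Lam n} (hf : IsLocallyFinite n f)
    (hg : IsLocallyFinite n g) (h : ∀ k l, Commute (f k) (g l)) (v : Fock n) :
    sumOp n f (sumOp n g v) = sumOp n g (sumOp n f v) := by
  have key : ∀ {f g : ℤ → Lam n} (hf : IsLocallyFinite n f) (hg : IsLocallyFinite n g),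
      (∀ k l, Commute (f k) (g l)) → sumOp n f (sumOp n g v) =
        ∑ k ∈ (hf v).toFinset, ∑ l ∈ (hg v).toFinset, (f k * g l) • v := by
    intro f g hf hg h
    have hgv : sumOp n g v = ∑ l ∈ (hg v).toFinset, g l • v := finsum_eq_sum _ (hg v)
    have hsum : ∀ k, f k • sumOp n g v = ∑ l ∈ (hg v).toFinset, (f k * g l) • v := fun k => by
      simp only [hgv, Finset.smul_sum, mul_smul]
    simp only [← hsum]
    refine finsum_eq_sum_of_support_subset _ fun k hk => ?_
    rw [Set.Finite.coe_toFinset]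
    refine fun hk' => hk ?_
    change f k • sumOp n g v = 0
    rw [hsum]
    refine Finset.sum_eq_zero fun l _ => ?_
    rw [(h k l).eq, mul_smul, show f k • v = 0 from hk', smul_zero]
  rw [key hf hg h, key hg hf fun k l => (h l k).symm, Finset.sum_comm]
  simp only [(h _ _).eq]

theorem epU_of_mem {n i : ℕ} (h : 1 ≤ i ∧ i ≤ n) :
    epU n i = unS n (some ⟨i - 1, by omega⟩) := dif_pos h

theorem epSt_of_mem {n i : ℕ} (h : 1 ≤ i ∧ i ≤ n) :
    epSt n i = stS n (some ⟨i - 1, by omega⟩) := dif_pos h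

/-- The normally ordered product of two boson series commutes with the product of a boson series
and the ghost series, provided the bosons commute. -/
theorem sumOp_nob_comm {n : ℕ} {a b d : ℤ → Lam n} (ha : IsFieldSeries n a)
    (hb : IsFieldSeries n b) (hd : IsFieldSeries n d) (hae : ∀ k l, Commute (a k) (eS n l))
    (hbe : ∀ k l, Commute (b k) (eS n l)) (hde : ∀ k l, Commute (d k) (eS n l))
    (had : ∀ k l, Commute (a k) (d l)) (hbd : ∀ k l, Commute (b k) (d l)) (c c' : ℂ) (m m' : ℤ)
    (v : Fock n) :
    sumOp n (fun k => c • nob n a b k (m - k))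
        (sumOp n (fun k => c' • (d k * eS n (m' - k))) v) =
      sumOp n (fun k => c' • (d k * eS n (m' - k)))
        (sumOp n (fun k => c • nob n a b k (m - k)) v) := by
  refine sumOp_comm ((ha.isLocallyFinite_nob hb m).smul c)
    ((hd.isLocallyFinite_mul (isFieldSeries_eS n) hde m').smul c') (fun k l => ?_) v
  refine Commute.smul_left (Commute.smul_right (Commute.nob_left ?_ ?_ _ _) _) _
  · exact fun j => (had j l).mul_right (hae j _)
  · exact fun j => (hbd j l).mul_right (hbe j _)

/-- For all 0 ≤ i ≤ n−2, all m, m' ∈ ℤ, and both choices of sign,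
[x_i^±(m), x_n^±(m')] = 0 on the Fock module V. -/
theorem distant_root_vectors_commute (n : ℕ) (hn : 2 ≤ n) (i : ℕ) (hi : i + 2 ≤ n)
    (m m' : ℤ) (v : Fock n) :
    (xp n i m (xp n n m' v) - xp n n m' (xp n i m v) = 0) ∧
    (xm n i m (xm n n m' v) - xm n n m' (xm n i m v) = 0) := by
  have hn₀ : n ≠ 0 := by omega
  have hin : i ≠ n := by omega
  have hU := epU_of_mem (n := n) (i := n) (by omega)
  have hS := epSt_of_mem (n := n) (i := n) (by omega)
  rw [sub_eq_zero, sub_eq_zero]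
  rcases Nat.eq_zero_or_pos i with rfl | hi₀
  · simp only [xp, xm, if_pos, if_neg hn₀, hU, hS]
    constructor
    · refine sumOp_nob_comm (isFieldSeries_stS n _) (isFieldSeries_stS n _) (isFieldSeries_unS n _)
        (stS_commute_eS n _) (stS_commute_eS n _) (unS_commute_eS n _) ?_ ?_ _ _ m m' v
      all_goals
        exact fun k l => (unS_commute_stS (pairB_some_none (by simp only; omega)) l k).symm
    · refine sumOp_nob_comm (isFieldSeries_unS n _) (isFieldSeries_unS n _) (isFieldSeries_stS n _)
        (unS_commute_eS n _) (unS_commute_eS n _) (stS_commute_eS n _) ?_ ?_ _ _ m m' v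
      all_goals
        exact unS_commute_stS (pairB_none_some (by simp only; omega))
  · have hi₁ : i ≠ 0 := hi₀.ne'
    simp only [xp, xm, if_pos, if_neg hn₀, if_neg hi₁, if_neg hin, hU, hS,
      epU_of_mem (n := n) (i := i) (by omega), epSt_of_mem (n := n) (i := i) (by omega),
      epU_of_mem (n := n) (i := i + 1) (by omega), epSt_of_mem (n := n) (i := i + 1) (by omega)]
    constructor
    · have := sumOp_nob_comm (isFieldSeries_unS n (some ⟨i - 1, by omega⟩))
        (isFieldSeries_stS n (some ⟨i + 1 - 1, by omega⟩))
        (isFieldSeries_unS n (some ⟨n - 1, by omega⟩))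
        (unS_commute_eS n _) (stS_commute_eS n _) (unS_commute_eS n _) (unS_commute_unS n _ _)
        (fun k l => (unS_commute_stS (pairB_some_some (by rw [Ne, Fin.mk.injEq]; omega)) l k).symm)
        1 (Real.sqrt 2 : ℝ) m m' v
      simpa only [one_smul] using this
    · have := sumOp_nob_comm (isFieldSeries_unS n (some ⟨i + 1 - 1, by omega⟩))
        (isFieldSeries_stS n (some ⟨i - 1, by omega⟩))
        (isFieldSeries_stS n (some ⟨n - 1, by omega⟩))
        (unS_commute_eS n _) (stS_commute_eS n _) (stS_commute_eS n _)
        (unS_commute_stS (pairB_some_some (by rw [Ne, Fin.mk.injEq]; omega))) (stS_commute_stS n _ _)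
        (-1) (-(Real.sqrt 2 : ℝ)) m m' v
      simpa only [neg_one_smul_lam] using this
end
end

section
/- For all m, m_1, m_2, m_3 ∈ ℤ and both choices of sign ±, the operators on the Fock module V satisfy the odd Serre relation [x_n^±(m_3), [x_n^±(m_2), [x_n^±(m_1), x_{n−1}^±(m)]]] = 0, where the super-brackets are determined by parity: the innermost bracket [x_n^±(m_1), x_{n−1}^±(m)] is the commutator (odd with even, resulting odd), the middle bracket is the anticommutator [x_n^±(m_2), ·]_+ = x_n^±(m_2)·(·) + (·)·x_n^±(m_2) (odd with odd, resulting even), and the outermost bracket is the commutator (odd with even). -/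
noncomputable section

open scoped BigOperators

/-- Commutator of operators on the Fock module. -/
def obrk (n : ℕ) (f g : Fock n → Fock n) : Fock n → Fock n := fun v => f (g v) - g (f v)

/-- Anticommutator of operators on the Fock module. -/
def abrk (n : ℕ) (f g : Fock n → Fock n) : Fock n → Fock n := fun v => f (g v) + g (f v)

section ModeSums

variable {R V : Type*} [Ring R] [AddCommGroup V] [Module R V]

/-- The additive operator `v ↦ ∑ k, f k • v` attached to a locally finite family `f`. -/
def modeSum (f : ℤ → R) (hf : ∀ v : V, (Function.support fun k => f k • v).Finite) : V →+ V where
  toFun v := ∑ᶠ k : ℤ, f k • v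
  map_zero' := by simp
  map_add' v w := by
    simp only [smul_add]
    exact finsum_add_distrib (hf v) (hf w)

theorem map_modeSum (T : V →+ V) (f : ℤ → R)
    (hf : ∀ v : V, (Function.support fun k => f k • v).Finite) (v : V) :
    T (modeSum f hf v) = ∑ᶠ k : ℤ, T (f k • v) :=
  T.map_finsum (hf v)

theorem finite_support_map (T : V →+ V) (f : ℤ → R)
    (hf : ∀ v : V, (Function.support fun k => f k • v).Finite) (v : V) :
    (Function.support fun k => T (f k • v)).Finite :=
  (hf v).subset fun k hk h => hk (by simp only [h, map_zero])

theorem map_modeSum_sub (T : V →+ V) (f g : ℤ → R)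
    (hf : ∀ v : V, (Function.support fun k => f k • v).Finite)
    (h : ∀ k v, T (f k • v) - f k • T v = g k • v) (v : V) :
    T (modeSum f hf v) - modeSum f hf (T v) = ∑ᶠ k : ℤ, g k • v := by
  rw [map_modeSum]
  exact (finsum_sub_distrib (finite_support_map T f hf v) (hf (T v))).symm.trans
    (finsum_congr fun k => h k v)

theorem map_modeSum_add (T : V →+ V) (f g : ℤ → R)
    (hf : ∀ v : V, (Function.support fun k => f k • v).Finite)
    (h : ∀ k v, T (f k • v) + f k • T v = g k • v) (v : V) :
    T (modeSum f hf v) + modeSum f hf (T v) = ∑ᶠ k : ℤ, g k • v := by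
  rw [map_modeSum]
  exact (finsum_add_distrib (finite_support_map T f hf v) (hf (T v))).symm.trans
    (finsum_congr fun k => h k v)

theorem modeSum_smul_sub (f : ℤ → R) (x : R)
    (hf : ∀ v : V, (Function.support fun k => f k • v).Finite) (v : V) :
    modeSum f hf (x • v) - x • modeSum f hf v = ∑ᶠ k : ℤ, (f k * x - x * f k) • v := by
  have h := map_modeSum_sub (DistribSMul.toAddMonoidHom V x) f (fun k => x * f k - f k * x) hf
    (fun k v => by simp [sub_smul, mul_smul]) v
  have h' := congrArg Neg.neg h
  rw [neg_sub, ← finsum_neg_distrib] at h'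
  refine h'.trans (finsum_congr fun k => ?_)
  rw [← neg_smul, neg_sub]

theorem modeSum_smul_add (f : ℤ → R) (x : R)
    (hf : ∀ v : V, (Function.support fun k => f k • v).Finite) (v : V) :
    modeSum f hf (x • v) + x • modeSum f hf v = ∑ᶠ k : ℤ, (f k * x + x * f k) • v := by
  rw [add_comm]
  exact map_modeSum_add (DistribSMul.toAddMonoidHom V x) f (fun k => f k * x + x * f k) hf
    (fun k v => by simp [add_smul, mul_smul, add_comm]) v

theorem modeSum_smul_of_commute (f : ℤ → R) (x : R)
    (hf : ∀ v : V, (Function.support fun k => f k • v).Finite) (h : ∀ k, Commute (f k) x) (v : V) :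
    modeSum f hf (x • v) = x • modeSum f hf v := by
  rw [← sub_eq_zero, modeSum_smul_sub]
  simp [fun k => (h k).eq]

theorem finite_support_mul (x y : ℤ → R) (hx : ∀ v : V, ∃ N, ∀ k ≥ N, x k • v = 0)
    (hy : ∀ v : V, ∃ N, ∀ k ≥ N, y k • v = 0) (hxy : ∀ k l, Commute (x k) (y l)) (m : ℤ) (v : V) :
    (Function.support fun k => (x k * y (m - k)) • v).Finite := by
  obtain ⟨N, hN⟩ := hx v
  obtain ⟨M, hM⟩ := hy v
  refine (Set.finite_Icc (m - M) N).subset fun k hk => ?_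
  by_contra h
  apply hk
  rw [Set.mem_Icc, not_and_or, not_le, not_le] at h
  rcases h with h | h
  · simp only [mul_smul, hM (m - k) (by omega), smul_zero]
  · simp only [(hxy k (m - k)).eq, mul_smul, hN k h.le, smul_zero]

/-- For `X p = ∑ a k e (p - k)` and `Y = ∑ b k a' (m - k)`, where `a` and `a'` are conjugate
bosons, `b` is a boson commuting with both, and `e` is a fermion, the triple bracket of `X`'s
with `Y` vanishes. -/
theorem odd_serre_modeSum (a a' b e : ℤ → R) (z : R) (hz : ∀ x, Commute z x)
    (haa : ∀ k l, Commute (a k) (a l)) (hab : ∀ k l, Commute (a k) (b l))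
    (hba' : ∀ k l, Commute (b k) (a' l)) (hae : ∀ k l, Commute (a k) (e l))
    (ha'e : ∀ k l, Commute (a' k) (e l)) (hbe : ∀ k l, Commute (b k) (e l))
    (haa' : ∀ k l, a k * a' l - a' l * a k = if k + l = 0 then z else 0)
    (hee : ∀ k l, e k * e l + e l * e k = if k + l = 0 then 1 else 0)
    (va : ∀ v : V, ∃ N, ∀ k ≥ N, a k • v = 0) (va' : ∀ v : V, ∃ N, ∀ k ≥ N, a' k • v = 0)
    (vb : ∀ v : V, ∃ N, ∀ k ≥ N, b k • v = 0) (ve : ∀ v : V, ∃ N, ∀ k ≥ N, e k • v = 0)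
    (m m1 m2 m3 : ℤ) (X : ℤ → V → V) (Y : V → V)
    (hX : ∀ p v, X p v = ∑ᶠ k : ℤ, (a k * e (p - k)) • v)
    (hY : ∀ v, Y v = ∑ᶠ k : ℤ, (b k * a' (m - k)) • v) :
    let Z := fun v => X m1 (Y v) - Y (X m1 v)
    let W := fun v => X m2 (Z v) + Z (X m2 v)
    ∀ v, X m3 (W v) - W (X m3 v) = 0 := by
  have fX (p : ℤ) := finite_support_mul a e va ve hae p
  have fY := finite_support_mul b a' vb va' hba' m
  obtain rfl : X = fun p => ⇑(modeSum _ (fX p)) := funext₂ hX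
  obtain rfl : Y = ⇑(modeSum _ fY) := funext hY
  have Xa (p l : ℤ) (v : V) := modeSum_smul_of_commute _ (a l) (fX p)
    (fun k => (haa k l).mul_left (hae l _).symm) v
  have Xb (p l : ℤ) (v : V) := modeSum_smul_of_commute _ (b l) (fX p)
    (fun k => (hab k l).mul_left (hbe l _).symm) v
  have Xz (p : ℤ) (v : V) := modeSum_smul_of_commute _ z (fX p) (fun k => (hz _).symm) v
  have Xa' (p l : ℤ) (v : V) : modeSum _ (fX p) (a' l • v) - a' l • modeSum _ (fX p) v =
      (z * e (p + l)) • v := by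
    rw [modeSum_smul_sub, finsum_eq_single _ (-l)]
    · rw [mul_assoc, ← (ha'e _ _).eq, ← mul_assoc, ← mul_assoc, ← sub_mul, haa']
      simp
    · intro k hk
      rw [mul_assoc, ← (ha'e _ _).eq, ← mul_assoc, ← mul_assoc, ← sub_mul, haa',
        if_neg (by omega)]
      simp
  have Xe (p l : ℤ) (v : V) : modeSum _ (fX p) (e l • v) + e l • modeSum _ (fX p) v =
      a (p + l) • v := by
    rw [modeSum_smul_add, finsum_eq_single _ (p + l)]
    · rw [← mul_assoc, ← (hae _ _).eq, mul_assoc, mul_assoc, ← mul_add, hee]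
      simp
    · intro k hk
      rw [← mul_assoc, ← (hae _ _).eq, mul_assoc, mul_assoc, ← mul_add, hee,
        if_neg (by omega)]
      simp
  have vbz (v : V) : ∃ N, ∀ k ≥ N, (b k * z) • v = 0 := by
    obtain ⟨N, hN⟩ := vb (z • v)
    exact ⟨N, fun k hk => by rw [mul_smul, hN k hk]⟩
  have fZ := finite_support_mul (fun k => b k * z) e vbz ve
    (fun k l => (hbe k l).mul_left (hz _)) (m1 + m)
  have fW := finite_support_mul (fun k => b k * z) a vbz va
    (fun k l => (hab l k).symm.mul_left (hz _)) (m2 + (m1 + m))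
  intro Z W
  have eZ : Z = ⇑(modeSum _ fZ) := funext fun v =>
    map_modeSum_sub (modeSum _ (fX m1)) _ _ fY (fun k v => by
      rw [mul_smul, mul_smul, Xb, ← smul_sub, Xa', ← mul_smul, mul_assoc, add_sub_assoc]) v
  have eW : W = ⇑(modeSum _ fW) := funext fun v => by
    simp only [W, eZ]
    exact map_modeSum_add (modeSum _ (fX m2)) _ _ fZ (fun k v => by
      simp only [mul_smul, Xb, Xz]
      rw [← smul_add, ← smul_add, Xe, add_sub_assoc m2]) v
  intro v
  rw [eW]
  refine (map_modeSum_sub (modeSum _ (fX m3)) _ (fun _ => 0) fW (fun k v => ?_) v).trans (by simp)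
  simp only [mul_smul, Xb, Xz, Xa, sub_self, zero_smul]

end ModeSums

theorem smul_mul_smul_sub_of_eq {A : Type*} [Ring A] [Algebra ℂ A] {x y : A} {r : ℂ}
    (h : x * y = y * x + algebraMap ℂ A r) (c d : ℂ) :
    (c • x) * (d • y) - (d • y) * (c • x) = algebraMap ℂ A (c * d * r) := by
  rw [smul_mul_smul_comm, smul_mul_smul_comm, mul_comm d c, ← smul_sub, h, add_sub_cancel_left,
    map_mul, Algebra.smul_def]

theorem Commute.neg_mul_eq_mul_neg_one_smul {A : Type*} [Ring A] [Algebra ℂ A] {x y : A}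
    (h : Commute x y) : -(x * y) = y * ((-1 : ℂ) • x) := by
  rw [mul_smul_comm, neg_one_smul, h.eq]

section Fock

variable {n : ℕ}

theorem commute_un_un (u v : BL n) (k l : ℤ) : Commute (gen n (.un u k)) (gen n (.un v l)) := by
  simpa [gen, commute_iff_eq] using RingQuot.mkAlgHom_rel ℂ (TRel.unun u v k l)

theorem commute_st_st (u v : BL n) (k l : ℤ) : Commute (gen n (.st u k)) (gen n (.st v l)) := by
  simpa [gen, commute_iff_eq] using RingQuot.mkAlgHom_rel ℂ (TRel.stst u v k l)

theorem commute_un_e (u : BL n) (k l : ℤ) : Commute (gen n (.un u k)) (gen n (.e l)) := by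
  simpa [gen, commute_iff_eq] using RingQuot.mkAlgHom_rel ℂ (TRel.une u k l)

theorem commute_st_e (u : BL n) (k l : ℤ) : Commute (gen n (.st u k)) (gen n (.e l)) := by
  simpa [gen, commute_iff_eq] using RingQuot.mkAlgHom_rel ℂ (TRel.ste u k l)

theorem gen_un_mul_st (u v : BL n) (k l : ℤ) :
    gen n (.un u k) * gen n (.st v l) = gen n (.st v l) * gen n (.un u k) +
      algebraMap ℂ (Lam n) (if k + l = 0 then pairB n u v else 0) := by
  have h := RingQuot.mkAlgHom_rel ℂ (TRel.unst u v k l)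
  rwa [map_add, map_mul, map_mul, AlgHom.commutes] at h

theorem gen_e_mul_e (k l : ℤ) :
    gen n (.e k) * gen n (.e l) + gen n (.e l) * gen n (.e k) = if k + l = 0 then 1 else 0 := by
  have h := RingQuot.mkAlgHom_rel ℂ (TRel.ee (n := n) k l)
  rw [map_add, map_mul, map_mul, AlgHom.commutes] at h
  refine h.trans ?_
  split_ifs <;> simp

theorem commute_un_st_of_pairB_eq_zero {u v : BL n} (h : pairB n u v = 0) (k l : ℤ) :
    Commute (gen n (.un u k)) (gen n (.st v l)) := by
  have := gen_un_mul_st u v k l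
  rwa [h, ite_self, map_zero, add_zero] at this

/-- Generators whose indices do not sum to zero commute up to sign. -/
theorem gen_mul_gen_eq_or (x y : TGen n) (h : x.idx + y.idx ≠ 0) :
    gen n x * gen n y = gen n y * gen n x ∨ gen n x * gen n y = -(gen n y * gen n x) := by
  rcases x with ⟨u, k⟩ | ⟨u, k⟩ | k <;> rcases y with ⟨v, l⟩ | ⟨v, l⟩ | l <;>
    simp only [TGen.idx] at h
  · exact .inl (commute_un_un u v k l)
  · exact .inl (by rw [gen_un_mul_st, if_neg h, map_zero, add_zero])
  · exact .inl (commute_un_e u k l)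
  · exact .inl (by rw [gen_un_mul_st, if_neg (by omega), map_zero, add_zero])
  · exact .inl (commute_st_st u v k l)
  · exact .inl (commute_st_e u k l)
  · exact .inl (commute_un_e v l k).symm
  · exact .inl (commute_st_e v l k).symm
  · exact .inr (eq_neg_of_add_eq_zero_left (by rw [gen_e_mul_e, if_neg h]))

/-- Every vector of the Fock module is annihilated by all generators of large index. -/
theorem exists_forall_gen_smul_eq_zero (v : Fock n) :
    ∃ N : ℤ, ∀ x : TGen n, N ≤ x.idx → gen n x • v = 0 := by
  have key (a : FreeAlgebra ℂ (TGen n)) : ∀ w : Fock n,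
      (∃ N : ℤ, ∀ x : TGen n, N ≤ x.idx → gen n x • w = 0) →
      ∃ N : ℤ, ∀ x : TGen n, N ≤ x.idx → gen n x • RingQuot.mkAlgHom ℂ (TRel n) a • w = 0 := by
    induction a using FreeAlgebra.induction with
    | grade0 r =>
      rintro w ⟨N, hN⟩
      refine ⟨N, fun x hx => ?_⟩
      rw [AlgHom.commutes, ← mul_smul, ← Algebra.commutes, mul_smul, hN x hx, smul_zero]
    | grade1 y =>
      rintro w ⟨N, hN⟩
      refine ⟨max N (1 - y.idx), fun x hx => ?_⟩
      change gen n x • gen n y • w = 0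
      rw [← mul_smul]
      have h0 := hN x ((le_max_left _ _).trans hx)
      have h1 := (le_max_right _ _).trans hx
      rcases gen_mul_gen_eq_or x y (by omega) with h | h <;>
        simp [h, mul_smul, h0]
    | mul a b ha hb =>
      intro w hw
      simpa only [map_mul, mul_smul] using ha _ (hb w hw)
    | add a b ha hb =>
      intro w hw
      obtain ⟨N, hN⟩ := ha w hw
      obtain ⟨M, hM⟩ := hb w hw
      refine ⟨max N M, fun x hx => ?_⟩
      rw [map_add, add_smul, smul_add, hN x ((le_max_left _ _).trans hx),
        hM x ((le_max_right _ _).trans hx), add_zero]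
  obtain ⟨c, rfl⟩ := Submodule.Quotient.mk_surjective _ v
  obtain ⟨a, rfl⟩ := RingQuot.mkAlgHom_surjective ℂ (TRel n) c
  have h := key a (Submodule.Quotient.mk 1) ⟨1, fun x hx => by
    rw [← Submodule.Quotient.mk_smul, smul_eq_mul, mul_one, Submodule.Quotient.mk_eq_zero]
    exact Submodule.subset_span ⟨x, hx, rfl⟩⟩
  simpa only [← Submodule.Quotient.mk_smul, smul_eq_mul, mul_one] using h

theorem exists_forall_smul_gen_smul_eq_zero (c : ℂ) (g : ℤ → TGen n) (hg : ∀ k, (g k).idx = k)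
    (v : Fock n) : ∃ N : ℤ, ∀ k ≥ N, (c • gen n (g k)) • v = 0 := by
  obtain ⟨N, hN⟩ := exists_forall_gen_smul_eq_zero v
  refine ⟨N, fun k hk => ?_⟩
  rw [← mul_one (gen n (g k)), ← mul_smul_comm, mul_smul, Algebra.smul_def, mul_one,
    ← mul_smul, ← Algebra.commutes, mul_smul, hN _ (by rw [hg]; exact hk), smul_zero]

theorem nob_of_commute (x y : ℤ → Lam n) (h : ∀ k l, Commute (x k) (y l)) (k l : ℤ) :
    nob n x y k l = x k * y l := by
  unfold nob
  split_ifs with h1 h2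
  · rfl
  · exact (h k l).eq.symm
  · obtain rfl : k = 0 := by omega
    rw [← (h 0 l).eq, ← two_smul ℂ, smul_smul]
    norm_num

end Fock

/-- Odd Serre relation: [x_n^±(m_3), [x_n^±(m_2), [x_n^±(m_1), x_{n−1}^±(m)]]] = 0 on the
Fock module V, for all m, m_1, m_2, m_3 ∈ ℤ and both choices of sign; the innermost and
outermost brackets are commutators (odd with even) and the middle bracket is the
anticommutator (odd with odd). -/
theorem serre_relation_odd (n : ℕ) (hn : 2 ≤ n) (m m1 m2 m3 : ℤ) :
    (obrk n (xp n n m3) (abrk n (xp n n m2) (obrk n (xp n n m1) (xp n (n - 1) m))) =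
      fun _ => 0) ∧
    (obrk n (xm n n m3) (abrk n (xm n n m2) (obrk n (xm n n m1) (xm n (n - 1) m))) =
      fun _ => 0) := by
  obtain ⟨i, j, hij, hi, hj⟩ : ∃ i j : Fin n, i ≠ j ∧ (i : ℕ) = n - 1 ∧ (j : ℕ) = n - 1 - 1 :=
    ⟨⟨n - 1, by omega⟩, ⟨n - 1 - 1, by omega⟩, by simp only [ne_eq, Fin.mk.injEq]; omega, rfl, rfl⟩
  have hn1 : n - 1 + 1 = n := by omega
  have eU : epU n n = unS n (some i) := by
    rw [epU, dif_pos ⟨by omega, le_rfl⟩]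
    exact congrArg (fun t => unS n (some t)) (Fin.ext hi.symm)
  have eS' : epSt n n = stS n (some i) := by
    rw [epSt, dif_pos ⟨by omega, le_rfl⟩]
    exact congrArg (fun t => stS n (some t)) (Fin.ext hi.symm)
  have eU1 : epU n (n - 1) = unS n (some j) := by
    rw [epU, dif_pos ⟨by omega, by omega⟩]
    exact congrArg (fun t => unS n (some t)) (Fin.ext hj.symm)
  have eS1 : epSt n (n - 1) = stS n (some j) := by
    rw [epSt, dif_pos ⟨by omega, by omega⟩]
    exact congrArg (fun t => stS n (some t)) (Fin.ext hj.symm)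
  have hii : pairB n (some i) (some i) = 1 := by simp [pairB]
  have cij := commute_un_st_of_pairB_eq_zero (n := n) (u := some i) (v := some j)
    (by simp [pairB, hij])
  have cji := commute_un_st_of_pairB_eq_zero (n := n) (u := some j) (v := some i)
    (by simp [pairB, hij.symm])
  have vgen := exists_forall_smul_gen_smul_eq_zero (n := n)
  have vgen1 (g : ℤ → TGen n) (hg : ∀ k, (g k).idx = k) (v : Fock n) :
      ∃ N : ℤ, ∀ k ≥ N, gen n (g k) • v = 0 := by
    simpa only [one_smul] using vgen 1 g hg v
  constructor
  · funext v
    refine odd_serre_modeSum (fun k => ((Real.sqrt 2 : ℝ) : ℂ) • gen n (.un (some i) k))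
      (fun k => gen n (.st (some i) k)) (fun k => gen n (.un (some j) k)) (fun k => gen n (.e k))
      (algebraMap ℂ _ ((Real.sqrt 2 : ℝ) : ℂ)) (fun x => Algebra.commutes _ x)
      (fun k l => ((commute_un_un _ _ k l).smul_left _).smul_right _)
      (fun k l => (commute_un_un _ _ k l).smul_left _) cji
      (fun k l => (commute_un_e _ k l).smul_left _) (commute_st_e _) (commute_un_e _)
      (fun k l => ?_) gen_e_mul_e (vgen _ _ fun _ => rfl) (vgen1 _ fun _ => rfl)
      (vgen1 _ fun _ => rfl) (vgen1 _ fun _ => rfl) m m1 m2 m3 (xp n n) (xp n (n - 1) m)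
      (fun p v => ?_) (fun v => ?_) v
    · have h := smul_mul_smul_sub_of_eq (gen_un_mul_st (some i) (some i) k l)
        ((Real.sqrt 2 : ℝ) : ℂ) 1
      rw [one_smul] at h
      refine h.trans ?_
      split_ifs <;> simp [hii]
    · rw [xp, if_neg (by omega), if_pos rfl, eU]
      exact finsum_congr fun k => by rw [smul_mul_assoc]; rfl
    · rw [xp, if_neg (by omega), if_neg (by omega), hn1, eU1, eS']
      exact finsum_congr fun k => congrArg (· • v) (nob_of_commute _ _ cji _ _)
  · funext v
    refine odd_serre_modeSum (fun k => (-((Real.sqrt 2 : ℝ) : ℂ)) • gen n (.st (some i) k))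
      (fun k => (-1 : ℂ) • gen n (.un (some i) k)) (fun k => gen n (.st (some j) k))
      (fun k => gen n (.e k))
      (algebraMap ℂ _ (-((Real.sqrt 2 : ℝ) : ℂ))) (fun x => Algebra.commutes _ x)
      (fun k l => ((commute_st_st _ _ k l).smul_left _).smul_right _)
      (fun k l => (commute_st_st _ _ k l).smul_left _) (fun k l => (cij l k).symm.smul_right _)
      (fun k l => (commute_st_e _ k l).smul_left _) (fun k l => (commute_un_e _ k l).smul_left _)
      (commute_st_e _) (fun k l => ?_) gen_e_mul_e (vgen _ _ fun _ => rfl) (vgen _ _ fun _ => rfl)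
      (vgen1 _ fun _ => rfl) (vgen1 _ fun _ => rfl) m m1 m2 m3 (xm n n) (xm n (n - 1) m)
      (fun p v => ?_) (fun v => ?_) v
    · have h := smul_mul_smul_sub_of_eq (gen_un_mul_st (some i) (some i) l k) (-1)
        (-((Real.sqrt 2 : ℝ) : ℂ))
      rw [← neg_sub, h, add_comm l k, ← map_neg]
      split_ifs <;> simp [hii]
    · rw [xm, if_neg (by omega), if_pos rfl, eS']
      exact finsum_congr fun k => by rw [smul_mul_assoc]; rfl
    · rw [xm, if_neg (by omega), if_neg (by omega), hn1, eU, eS1]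
      refine (finsum_comp_equiv (Equiv.subLeft m)).symm.trans (finsum_congr fun k => ?_)
      rw [← (cij _ _).neg_mul_eq_mul_neg_one_smul, Equiv.subLeft_apply]
      refine congrArg (fun t => -t • v) ((nob_of_commute _ _ cij _ _).trans ?_)
      rw [sub_sub_cancel]
end
end
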